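/- Let β > 0, set c_β = (cosh β + 1)/(cosh β − 1) and σ_β(θ) = (cosh β + 1)/(cosh β − cos(2πθ)). Let B : ℝ → ℝ be continuous, and fix x ≥ 0 and μ > 0. Then lim_{ε → 0⁺} ∫_{0}^{1} B(E) · (1 − exp(−x·σ_β(E/ε)/μ)) dE = (∫_{0}^{1} B(E) dE) · ((cosh β + 1)/π) · ∫_{1}^{c_β} (1 − exp(−x·ξ/μ)) / (ξ² · √(1 − (ξ·cosh β − cosh β − 1)²/ξ²)) dξ. -/

import Mathlib

open MeasureTheory Filter

/-- The primitive of a continuous periodic function of mean zero is bounded. -/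
lemma Function.Periodic.exists_abs_integral_le {h : ℝ → ℝ} (hp : Function.Periodic h 1)
    (hc : Continuous h) (h0 : ∫ t in (0:ℝ)..1, h t = 0) :
    ∃ M, ∀ t, |∫ s in (0:ℝ)..t, h s| ≤ M := by
  have hper : Function.Periodic (fun t => ∫ s in (0:ℝ)..t, h s) 1 := by
    intro t
    have := hp.intervalIntegral_add_eq_add 0 t fun _ _ => hc.intervalIntegrable _ _
    simpa [h0] using this
  have hcont : Continuous fun t => ∫ s in (0:ℝ)..t, h s :=
    intervalIntegral.continuous_primitive (fun _ _ => hc.intervalIntegrable _ _) 0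
  obtain ⟨M, hM⟩ := (hper.isBounded_of_continuous one_ne_zero hcont).exists_norm_le
  exact ⟨M, fun t => hM _ ⟨t, rfl⟩⟩

/-- Oscillatory integrals of a rapidly rescaled periodic function of mean zero against a
polynomial are of the order of the scale. -/
lemma Function.Periodic.exists_abs_integral_polynomial_mul_le {h : ℝ → ℝ}
    (hp : Function.Periodic h 1) (hc : Continuous h) (h0 : ∫ t in (0:ℝ)..1, h t = 0)
    (P : Polynomial ℝ) :
    ∃ A, ∀ ε : ℝ, 0 < ε → |∫ E in (0:ℝ)..1, P.eval E * h (E / ε)| ≤ ε * A := by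
  obtain ⟨M, hM⟩ := hp.exists_abs_integral_le hc h0
  obtain ⟨D, hD⟩ := isCompact_Icc.exists_bound_of_continuousOn
    (s := Set.Icc (0:ℝ) 1) P.derivative.continuous.continuousOn
  have hD0 : 0 ≤ D := (norm_nonneg _).trans (hD 0 (by simp))
  refine ⟨|P.eval 1| * M + D * M, fun ε hε => ?_⟩
  have hv (E : ℝ) : HasDerivAt (fun E => ε * ∫ s in (0:ℝ)..E / ε, h s) (h (E / ε)) E := by
    have h1 := intervalIntegral.integral_hasDerivAt_right (a := 0) (b := E / ε)
      (hc.intervalIntegrable _ _) (hc.stronglyMeasurableAtFilter _ _)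
      hc.continuousAt
    have h2 := ((h1.comp E ((hasDerivAt_id E).div_const ε)).const_mul ε)
    convert! h2 using 1
    field_simp
  rw [intervalIntegral.integral_mul_deriv_eq_deriv_mul (fun E _ => P.hasDerivAt E)
    (fun E _ => hv E) (P.derivative.continuous.intervalIntegrable _ _)
    ((by fun_prop : Continuous fun E => h (E / ε)).intervalIntegrable _ _)]
  have hI : ‖∫ E in (0:ℝ)..1, P.derivative.eval E * (ε * ∫ s in (0:ℝ)..E / ε, h s)‖
      ≤ D * (ε * M) * |1 - 0| := by
    refine intervalIntegral.norm_integral_le_of_norm_le_const fun E hE => ?_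
    rw [Set.uIoc_of_le zero_le_one] at hE
    rw [norm_mul, norm_mul, Real.norm_of_nonneg hε.le]
    gcongr
    · exact hD E ⟨hE.1.le, hE.2⟩
    · exact hM _
  have hb : |P.eval 1 * (ε * ∫ s in (0:ℝ)..1 / ε, h s)| ≤ |P.eval 1| * (ε * M) := by
    rw [abs_mul, abs_mul, abs_of_pos hε]
    gcongr
    exact hM _
  rw [Real.norm_eq_abs] at hI
  simp only [zero_div, intervalIntegral.integral_same, mul_zero, sub_zero, abs_one,
    mul_one] at hI ⊢
  refine (abs_sub _ _).trans ?_
  linarith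

/-- Averaging of a rapidly rescaled continuous periodic function of mean zero. -/
lemma Function.Periodic.tendsto_integral_mul_of_integral_eq_zero {h : ℝ → ℝ}
    (hp : Function.Periodic h 1) (hc : Continuous h) (h0 : ∫ t in (0:ℝ)..1, h t = 0)
    {B : ℝ → ℝ} (hB : Continuous B) :
    Tendsto (fun ε : ℝ => ∫ E in (0:ℝ)..1, B E * h (E / ε))
      (nhdsWithin 0 (Set.Ioi 0)) (nhds 0) := by
  obtain ⟨K, hK⟩ := (hp.isBounded_of_continuous one_ne_zero hc).exists_norm_le
  replace hK (t : ℝ) : ‖h t‖ ≤ K := hK _ ⟨t, rfl⟩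
  have hK0 : 0 ≤ K := (norm_nonneg _).trans (hK 0)
  rw [Metric.tendsto_nhds]
  intro δ hδ
  obtain ⟨P, hP⟩ := exists_polynomial_near_of_continuousOn 0 1 B hB.continuousOn
    (δ / (2 * (K + 1))) (by positivity)
  obtain ⟨A, hA⟩ := hp.exists_abs_integral_polynomial_mul_le hc h0 P
  have hsmall : ∀ᶠ ε : ℝ in nhdsWithin 0 (Set.Ioi 0), ε * A < δ / 2 := by
    have : Tendsto (fun ε : ℝ => ε * A) (nhdsWithin 0 (Set.Ioi 0)) (nhds (0 * A)) :=
      ((continuous_mul_const A).tendsto 0).mono_left nhdsWithin_le_nhds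
    rw [zero_mul] at this
    exact this.eventually_lt_const (by positivity)
  filter_upwards [hsmall, self_mem_nhdsWithin] with ε hε hε0
  have hcε : Continuous fun E => h (E / ε) := by fun_prop
  have hsplit : ∫ E in (0:ℝ)..1, B E * h (E / ε) =
      (∫ E in (0:ℝ)..1, P.eval E * h (E / ε)) -
        ∫ E in (0:ℝ)..1, (P.eval E - B E) * h (E / ε) := by
    rw [← intervalIntegral.integral_sub
      (Continuous.intervalIntegrable (by fun_prop) _ _)
      (Continuous.intervalIntegrable (by fun_prop) _ _)]
    congr 1
    ext E
    ring
  have hR : ‖∫ E in (0:ℝ)..1, (P.eval E - B E) * h (E / ε)‖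
      ≤ δ / (2 * (K + 1)) * K * |1 - 0| := by
    refine intervalIntegral.norm_integral_le_of_norm_le_const fun E hE => ?_
    rw [Set.uIoc_of_le zero_le_one] at hE
    rw [norm_mul]
    gcongr
    · exact (hP E ⟨hE.1.le, hE.2⟩).le
    · exact hK _
  have hδK : δ / (2 * (K + 1)) * K ≤ δ / 2 := by
    rw [div_mul_eq_mul_div, div_le_div_iff₀ (by positivity) (by positivity)]
    nlinarith
  rw [Real.norm_eq_abs, sub_zero, abs_one, mul_one] at hR
  rw [Real.dist_eq, sub_zero, hsplit]
  refine (abs_sub _ _).trans_lt ?_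
  linarith [hA ε hε0]

/-- A rapidly rescaled continuous periodic function converges weakly to its mean. -/
lemma Function.Periodic.tendsto_integral_mul {g : ℝ → ℝ}
    (hp : Function.Periodic g 1) (hc : Continuous g) {B : ℝ → ℝ} (hB : Continuous B) :
    Tendsto (fun ε : ℝ => ∫ E in (0:ℝ)..1, B E * g (E / ε))
      (nhdsWithin 0 (Set.Ioi 0))
      (nhds ((∫ E in (0:ℝ)..1, B E) * ∫ t in (0:ℝ)..1, g t)) := by
  set m := ∫ t in (0:ℝ)..1, g t with hm
  have hp' : Function.Periodic (fun t => g t - m) 1 := fun t => by simp only [hp t]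
  have h0 : ∫ t in (0:ℝ)..1, (g t - m) = 0 := by
    rw [intervalIntegral.integral_sub (hc.intervalIntegrable _ _) (by simp)]
    simp [hm]
  have key := (hp'.tendsto_integral_mul_of_integral_eq_zero
    (hc.sub continuous_const) h0 hB).add_const ((∫ E in (0:ℝ)..1, B E) * m)
  rw [zero_add] at key
  refine key.congr fun ε => ?_
  have hcε : Continuous fun E => g (E / ε) := by fun_prop
  rw [← intervalIntegral.integral_mul_const, ← intervalIntegral.integral_add
    (Continuous.intervalIntegrable (by fun_prop) _ _)
    (Continuous.intervalIntegrable (by fun_prop) _ _)]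
  congr 1
  ext E
  ring

/-- The law of the Elsasser band profile under the uniform measure on a period. -/
lemma integral_comp_elsasser {C : ℝ} (hC : 1 < C) {F : ℝ → ℝ} (hF : Continuous F) :
    ∫ θ in (0:ℝ)..1, F ((C + 1) / (C - Real.cos (2 * Real.pi * θ))) =
      ((C + 1) / Real.pi) * ∫ ξ in (1:ℝ)..((C + 1) / (C - 1)),
        F ξ / (ξ ^ 2 * Real.sqrt (1 - (ξ * C - C - 1) ^ 2 / ξ ^ 2)) := by
  set σ : ℝ → ℝ := fun θ => (C + 1) / (C - Real.cos (2 * Real.pi * θ)) with hσ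
  have hpos (θ : ℝ) : 0 < C - Real.cos (2 * Real.pi * θ) := by
    linarith [Real.cos_le_one (2 * Real.pi * θ)]
  have hσc : Continuous σ := by
    refine continuous_const.div (by fun_prop) fun θ => (hpos θ).ne'
  have hsin {θ : ℝ} (hθ : θ ∈ Set.Ioo (0:ℝ) (1 / 2)) : 0 < Real.sin (2 * Real.pi * θ) :=
    Real.sin_pos_of_pos_of_lt_pi (by have := hθ.1; positivity)
      (by nlinarith [Real.pi_pos, hθ.2])
  set σ' : ℝ → ℝ := fun θ =>
    -((C + 1) * (2 * Real.pi * Real.sin (2 * Real.pi * θ)) /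
      (C - Real.cos (2 * Real.pi * θ)) ^ 2) with hσ'
  have hderiv (θ : ℝ) : HasDerivAt σ (σ' θ) θ := by
    have h1 : HasDerivAt (fun θ : ℝ => 2 * Real.pi * θ) (2 * Real.pi) θ := by
      simpa using (hasDerivAt_id θ).const_mul (2 * Real.pi)
    have h2 := (hasDerivAt_const θ (C + 1)).div ((h1.cos).const_sub C) (hpos θ).ne'
    convert! h2 using 1
    simp only [hσ']
    ring
  have hcv := integral_Icc_deriv_smul_of_deriv_nonpos (a := 0) (b := 1 / 2)
    (f := σ) (f' := σ')
    (g := fun ξ => F ξ / (ξ ^ 2 * Real.sqrt (1 - (ξ * C - C - 1) ^ 2 / ξ ^ 2)))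
    hσc.continuousOn (fun θ _ => hderiv θ)
    (fun θ hθ => by
      have := hsin hθ
      have := hpos θ
      simp only [hσ', Left.neg_nonpos_iff]
      positivity) (by norm_num)
  have hσ0 : σ 0 = (C + 1) / (C - 1) := by simp [hσ]
  have hσ1 : σ (1 / 2) = 1 := by
    simp only [hσ]
    rw [show 2 * Real.pi * (1 / 2) = Real.pi by ring, Real.cos_pi, sub_neg_eq_add]
    exact div_self (by linarith)
  have hle : 1 ≤ (C + 1) / (C - 1) := by
    rw [le_div_iff₀ (by linarith)]
    linarith
  have hpt : ∀ θ ∈ Set.Ioo (0:ℝ) (1 / 2),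
      σ' θ • (F (σ θ) / (σ θ ^ 2 * Real.sqrt (1 - (σ θ * C - C - 1) ^ 2 / σ θ ^ 2))) =
        -(2 * Real.pi / (C + 1)) * F (σ θ) := by
    intro θ hθ
    have hs := hsin hθ
    have hd := hpos θ
    have hC1 : 0 < C + 1 := by linarith
    have hσθ : 0 < σ θ := div_pos hC1 hd
    have hnum : σ θ * C - C - 1 = σ θ * Real.cos (2 * Real.pi * θ) := by
      simp only [hσ]
      field_simp
      ring
    have hsqrt : Real.sqrt (1 - (σ θ * C - C - 1) ^ 2 / σ θ ^ 2) =
        Real.sin (2 * Real.pi * θ) := by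
      rw [hnum, mul_pow, mul_div_cancel_left₀ _ (by positivity), ← Real.sin_sq,
        Real.sqrt_sq hs.le]
    have hq : σ' θ = -(2 * Real.pi / (C + 1)) * (σ θ ^ 2 * Real.sin (2 * Real.pi * θ)) := by
      simp only [hσ', hσ]
      field_simp
    rw [hsqrt, hq, smul_eq_mul]
    field_simp
  rw [integral_Icc_eq_integral_Ioo, setIntegral_congr_fun measurableSet_Ioo hpt,
    integral_const_mul, ← integral_Ioc_eq_integral_Ioo,
    ← intervalIntegral.integral_of_le (by norm_num), hσ0, hσ1, integral_Icc_eq_integral_Ioc,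
    ← intervalIntegral.integral_of_le hle] at hcv
  have hFσ (a b : ℝ) : IntervalIntegrable (fun θ => F (σ θ)) volume a b :=
    (hF.comp hσc).intervalIntegrable _ _
  have hsymm : ∫ θ in (1 / 2 : ℝ)..1, F (σ θ) = ∫ θ in (0:ℝ)..(1 / 2), F (σ θ) := by
    have := intervalIntegral.integral_comp_sub_left (fun θ => F (σ θ)) (1:ℝ)
      (a := 0) (b := 1 / 2)
    rw [sub_zero, show (1:ℝ) - 1 / 2 = 1 / 2 by norm_num] at this
    rw [← this]
    congr 1
    ext θ
    simp only [hσ]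
    rw [mul_sub, mul_one, Real.cos_two_pi_sub]
  rw [← intervalIntegral.integral_add_adjacent_intervals (hFσ 0 (1 / 2)) (hFσ (1 / 2) 1), hsymm,
    ← neg_eq_iff_eq_neg.mpr hcv]
  have : C + 1 ≠ 0 := by linarith
  field_simp
  ring

/-- Homogenized energy-integrated intensity for the Elsasser band model: with
`σ_β(θ) = (cosh β + 1)/(cosh β - cos (2πθ))`, `c_β = (cosh β + 1)/(cosh β - 1)`,
continuous `B`, `x ≥ 0` and `μ > 0`,
`∫_0^1 B(E)(1 - e^{-x σ_β(E/ε)/μ}) dE` converges as `ε → 0⁺` to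
`(∫_0^1 B) · ((cosh β + 1)/π) ∫_1^{c_β} (1 - e^{-xξ/μ}) /
  (ξ² √(1 - (ξ cosh β - cosh β - 1)²/ξ²)) dξ`. -/
theorem elsasser_homogenized_intensity (β : ℝ) (hβ : 0 < β)
    (B : ℝ → ℝ) (hB : Continuous B) (x : ℝ) (hx : 0 ≤ x) (μ : ℝ) (hμ : 0 < μ) :
    Tendsto
      (fun ε : ℝ =>
        ∫ E in (0:ℝ)..1,
          B E * (1 - Real.exp
            (-x * ((Real.cosh β + 1) /
              (Real.cosh β - Real.cos (2 * Real.pi * (E / ε)))) / μ)))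
      (nhdsWithin 0 (Set.Ioi 0))
      (nhds ((∫ E in (0:ℝ)..1, B E) * ((Real.cosh β + 1) / Real.pi) *
        ∫ ξ in (1:ℝ)..((Real.cosh β + 1) / (Real.cosh β - 1)),
          (1 - Real.exp (-x * ξ / μ)) /
            (ξ ^ 2 * Real.sqrt (1 - (ξ * Real.cosh β - Real.cosh β - 1) ^ 2 / ξ ^ 2)))) := by
  have hC : 1 < Real.cosh β := Real.one_lt_cosh.mpr hβ.ne'
  set g : ℝ → ℝ := fun θ => 1 - Real.exp
    (-x * ((Real.cosh β + 1) / (Real.cosh β - Real.cos (2 * Real.pi * θ))) / μ) with hg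
  have hp : Function.Periodic g 1 := fun θ => by
    simp only [hg, mul_add, mul_one, Real.cos_add_two_pi]
  have hF : Continuous fun ξ : ℝ => 1 - Real.exp (-x * ξ / μ) := by fun_prop
  have hc : Continuous g := by
    refine hF.comp (continuous_const.div (by fun_prop) fun θ => ?_)
    linarith [Real.cos_le_one (2 * Real.pi * θ)]
  rw [mul_assoc, ← integral_comp_elsasser hC hF]
  exact hp.tendsto_integral_mul hc hB
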